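/- Let s ≥ 2 and n ≥ 3 be integers, let a ≤ b−1 be integers and c = b − a ≥ 1. Choose a weight function w : X → {a, a+1, …, b−1} uniformly at random (equivalently, all values w(e) are independent and uniformly distributed integers in [a, b−1]), where X is the set of all vectors. Let α(w) be the number of feasible assignments whose total weight equals a·n. If ((n−1)/e)^{s−1} ≥ c · 2^{1/(n−1)} (where e is Euler's number), then the probability that α = 0 is at most exp(−1/(2σ)), where σ = Σ_{k=1}^{n−2} [ C(n,k) · c^k / (n·(n−1)···(n−k+1))^{s−1} ]. -/

import Mathlib

/-- `swapVec u v D` is the vector equal to `v` in dimensions in `D` and to `u` otherwise. -/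
def swapVec {s n : ℕ} (u v : Fin s → Fin n) (D : Finset (Fin s)) : Fin s → Fin n :=
  fun j => if j ∈ D then v j else u j

/-- `pD A D ρ` is the assignment whose `i`-th vector is `swap (A i) (A (ρ i)) D`. -/
def pD {s n : ℕ} (A : Fin n → Fin s → Fin n) (D : Finset (Fin s)) (ρ : Equiv.Perm (Fin n)) :
    Fin n → Fin s → Fin n :=
  fun i => swapVec (A i) (A (ρ i)) D

/-- An assignment is feasible if in every dimension the coordinates are pairwise distinct. -/
def Feasible {s n : ℕ} (A : Fin n → Fin s → Fin n) : Prop :=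
  ∀ j : Fin s, Function.Injective fun i => A i j

/-- The set of vectors of an assignment. -/
def vecSet {s n : ℕ} (A : Fin n → Fin s → Fin n) : Finset (Fin s → Fin n) :=
  Finset.image A Finset.univ

open Finset in
theorem aux_count {X : Type*} [Fintype X] [DecidableEq X] (I : Finset ℤ) (a : ℤ) (ha : a ∈ I)
    (T : Finset X) (g : (X → ℤ) → Prop) [DecidablePred g] :
    #{w ∈ Fintype.piFinset (fun _ : X => I) | g (fun x => if x ∈ T then a else w x)} =
    #{w ∈ Fintype.piFinset (fun _ : X => I) | (∀ x ∈ T, w x = a) ∧ g w} * #I ^ #T := by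
  classical
  have H : Set.MapsTo (fun (w : X → ℤ) x => if x ∈ T then a else w x)
      (({w ∈ Fintype.piFinset (fun _ : X => I) | g (fun x => if x ∈ T then a else w x)} :
        Finset (X → ℤ)) : Set (X → ℤ))
      ({w ∈ Fintype.piFinset (fun _ : X => I) | (∀ x ∈ T, w x = a) ∧ g w} :
        Finset (X → ℤ)) := by
    intro w hw
    simp only [coe_filter, Fintype.mem_piFinset, Set.mem_ofPred_eq] at hw ⊢
    refine ⟨fun x => ?_, fun x hx => if_pos hx, hw.2⟩
    by_cases hx : x ∈ T
    · simpa [hx] using ha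
    · simpa [hx] using hw.1 x
  rw [Finset.card_eq_sum_card_fiberwise H]
  apply Finset.sum_const_nat
  intro v hv
  simp only [mem_filter, Fintype.mem_piFinset] at hv
  have : ({w ∈ {w ∈ Fintype.piFinset (fun _ : X => I) | g (fun x => if x ∈ T then a else w x)} |
      (fun x => if x ∈ T then a else w x) = v} : Finset (X → ℤ)) =
      Fintype.piFinset (fun x => if x ∈ T then I else {v x}) := by
    ext w
    simp only [mem_filter, Fintype.mem_piFinset]
    constructor
    · rintro ⟨⟨h1, h2⟩, h3⟩ x
      by_cases hx : x ∈ T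
      · simpa [hx] using h1 x
      · have := congrFun h3 x
        simpa [hx] using this
    · intro h
      have h3 : (fun x => if x ∈ T then a else w x) = v := by
        funext x
        by_cases hx : x ∈ T
        · simp [hx, hv.2.1 x hx]
        · have := h x
          simpa [hx] using this
      refine ⟨⟨fun x => ?_, by rw [h3]; exact hv.2.2⟩, h3⟩
      have h4 := h x
      by_cases hx : x ∈ T
      · simpa [hx] using h4
      · simp only [hx, if_false, mem_singleton] at h4
        rw [h4]; exact hv.1 x
  rw [this, Fintype.card_piFinset]
  have h5 : ∀ x : X, #(if x ∈ T then I else {v x}) = if x ∈ T then #I else 1 := by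
    intro x; split_ifs <;> simp
  simp [h5]

/-- The functional of the Boppana–Spencer bound. -/
noncomputable def auxL {ι : Type*} (p : ι → ℝ) (d : ι → ι → ℝ) (R : Finset ι) : ℝ :=
  ∑ i ∈ R, p i - (∑ i ∈ R, ∑ j ∈ R, d i j) / 2

theorem auxL_insert {ι : Type*} [DecidableEq ι] (p : ι → ℝ) (d : ι → ι → ℝ)
    (hsym : ∀ i j, d i j = d j i) (hdiag : ∀ i, d i i = 0) (R : Finset ι) (x : ι) (hx : x ∉ R) :
    auxL p d (insert x R) = auxL p d R + (p x - ∑ j ∈ R, d x j) := by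
  unfold auxL
  simp only [Finset.sum_insert hx, hdiag, Finset.sum_add_distrib]
  have : ∑ i ∈ R, d i x = ∑ i ∈ R, d x i := Finset.sum_congr rfl fun i _ => hsym i x
  rw [this]; ring

theorem aux_thin {ι : Type*} [DecidableEq ι] (d : ι → ι → ℝ)
    (hsym : ∀ i j, d i j = d j i) (hdiag : ∀ i, d i i = 0) (q : ℝ) (hq0 : 0 ≤ q) (hq1 : q ≤ 1)
    (F : Finset ι) : ∀ p : ι → ℝ, ∃ R ⊆ F,
      q * ∑ i ∈ F, p i - q ^ 2 * (∑ i ∈ F, ∑ j ∈ F, d i j) / 2 ≤ auxL p d R := by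
  induction F using Finset.induction_on with
  | empty => intro p; exact ⟨∅, subset_rfl, by simp [auxL]⟩
  | insert x F hx ih =>
    intro p
    obtain ⟨R0, hR0, h0⟩ := ih p
    obtain ⟨R1, hR1, h1⟩ := ih (fun i => p i - d x i)
    have e1 : auxL p d (insert x R1) = p x + auxL (fun i => p i - d x i) d R1 := by
      rw [auxL_insert p d hsym hdiag _ _ (fun h => hx (hR1 h))]
      unfold auxL
      rw [Finset.sum_sub_distrib]; ring
    have e2 : ∑ i ∈ F, d i x = ∑ i ∈ F, d x i := Finset.sum_congr rfl fun i _ => hsym i x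
    have key : q * ∑ i ∈ insert x F, p i
        - q ^ 2 * (∑ i ∈ insert x F, ∑ j ∈ insert x F, d i j) / 2 ≤
        q * auxL p d (insert x R1) + (1 - q) * auxL p d R0 := by
      have a1 := mul_le_mul_of_nonneg_left h1 hq0
      have a0 := mul_le_mul_of_nonneg_left h0 (sub_nonneg.2 hq1)
      rw [e1]
      have e3 : q * ∑ i ∈ insert x F, p i
        - q ^ 2 * (∑ i ∈ insert x F, ∑ j ∈ insert x F, d i j) / 2 = q * p x +
        q * (q * ∑ i ∈ F, (p i - d x i) - q ^ 2 * (∑ i ∈ F, ∑ j ∈ F, d i j) / 2) +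
        (1 - q) * (q * ∑ i ∈ F, p i - q ^ 2 * (∑ i ∈ F, ∑ j ∈ F, d i j) / 2) := by
        simp only [Finset.sum_insert hx, hdiag, Finset.sum_add_distrib, Finset.sum_sub_distrib, e2]
        ring
      rw [e3, mul_add]
      exact add_le_add (add_le_add le_rfl a1) a0
    by_cases hle : auxL p d (insert x R1) ≤ auxL p d R0
    · refine ⟨R0, hR0.trans (Finset.subset_insert _ _), key.trans ?_⟩
      nlinarith
    · refine ⟨insert x R1, Finset.insert_subset_insert _ hR1, key.trans ?_⟩
      push Not at hle
      nlinarith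

open Finset in
theorem aux_janson {X ι : Type*} [Fintype X] [DecidableEq X] [DecidableEq ι]
    (I : Finset ℤ) (a : ℤ) (ha : a ∈ I) (S : ι → Finset X) (d : ι → ι → ℝ)
    (hsym : ∀ i j, d i j = d j i) (hdiag : ∀ i, d i i = 0)
    (hd0 : ∀ i j, 0 ≤ d i j)
    (hd : ∀ i j, i ≠ j → ¬ Disjoint (S i) (S j) → d i j = 1 / (#I : ℝ) ^ #(S i ∪ S j))
    (R : Finset ι) :
    (#{w ∈ Fintype.piFinset (fun _ : X => I) | ∀ i ∈ R, ¬ ∀ x ∈ S i, w x = a} : ℝ) ≤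
      #(Fintype.piFinset (fun _ : X => I)) *
        Real.exp (-auxL (fun i => 1 / (#I : ℝ) ^ #(S i)) d R) := by
  classical
  have hI : (0 : ℝ) < #I := by exact_mod_cast Finset.card_pos.2 ⟨a, ha⟩
  induction R using Finset.induction_on with
  | empty => simp [auxL]
  | insert i R hi ih =>
    set Ω := Fintype.piFinset (fun _ : X => I) with hΩ
    set P : ι → ℝ := fun i => 1 / (#I : ℝ) ^ #(S i) with hP
    rw [auxL_insert P d hsym hdiag _ _ hi]
    set t : ℝ := P i - ∑ j ∈ R, d i j with ht
    set N : ℝ := (#{w ∈ Ω | ∀ i ∈ R, ¬ ∀ x ∈ S i, w x = a} : ℝ) with hN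
    -- the decreasing event
    let Z : (X → ℤ) → Prop := fun w => ∀ j ∈ R, Disjoint (S i) (S j) → ¬ ∀ x ∈ S j, w x = a
    have hNZ : N ≤ #{w ∈ Ω | Z w} := by
      rw [hN]; norm_cast
      apply card_le_card
      intro w hw
      simp only [mem_filter] at hw ⊢
      exact ⟨hw.1, fun j hj _ => hw.2 j hj⟩
    have hind : (#{w ∈ Ω | (∀ x ∈ S i, w x = a) ∧ Z w} : ℝ) = P i * #{w ∈ Ω | Z w} := by
      have h1 := aux_count I a ha (S i) Z
      have h2 : ∀ w : X → ℤ, Z (fun x => if x ∈ S i then a else w x) ↔ Z w := by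
        intro w
        refine forall_congr' fun j => forall_congr' fun _ => forall_congr' fun hdj => not_congr ?_
        refine forall_congr' fun x => forall_congr' fun hx => ?_
        dsimp only
        rw [if_neg (fun h => (Finset.disjoint_left.1 hdj h) hx)]
      simp only [h2] at h1
      rw [h1, hP]; push_cast; field_simp
      rfl
    have hFKG : ∀ j ∈ R, ¬ Disjoint (S i) (S j) →
        (#{w ∈ Ω | (∀ x ∈ S i ∪ S j, w x = a) ∧ Z w} : ℝ) ≤ d i j * #{w ∈ Ω | Z w} := by
      intro j hj hdj
      rw [hd i j (fun h => hi (h ▸ hj)) hdj]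
      have h1 := aux_count I a ha (S i ∪ S j) Z
      have h2 : #{w ∈ Ω | Z (fun x => if x ∈ S i ∪ S j then a else w x)} ≤ #{w ∈ Ω | Z w} := by
        apply card_le_card
        intro w hw
        simp only [mem_filter] at hw ⊢
        refine ⟨hw.1, fun k hk hdk hall => hw.2 k hk hdk fun x hx => ?_⟩
        dsimp only
        split_ifs
        · rfl
        · exact hall x hx
      rw [h1] at h2
      have h3 : (#{w ∈ Ω | (∀ x ∈ S i ∪ S j, w x = a) ∧ Z w} : ℝ) * (#I : ℝ) ^ #(S i ∪ S j) ≤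
        #{w ∈ Ω | Z w} := by exact_mod_cast h2
      rw [one_div_mul_eq_div, le_div_iff₀ (by positivity)]
      exact h3
    have hunion : #{w ∈ Ω | (∀ x ∈ S i, w x = a) ∧ Z w} ≤
        #{w ∈ Ω | (∀ x ∈ S i, w x = a) ∧ ∀ j ∈ R, ¬ ∀ x ∈ S j, w x = a} +
        ∑ j ∈ R with ¬ Disjoint (S i) (S j), #{w ∈ Ω | (∀ x ∈ S i ∪ S j, w x = a) ∧ Z w} := by
      refine le_trans (card_le_card ?_) ((card_union_le _ _).trans
        (Nat.add_le_add_left (card_biUnion_le (s := {j ∈ R | ¬ Disjoint (S i) (S j)})) _))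
      intro w hw
      simp only [mem_filter, mem_union, mem_biUnion] at hw ⊢
      by_cases h : ∀ j ∈ R, ¬ ∀ x ∈ S j, w x = a
      · exact Or.inl ⟨hw.1, hw.2.1, h⟩
      · right
        push Not at h
        obtain ⟨j, hj, hjx⟩ := h
        refine ⟨j, ⟨hj, fun hdj => hw.2.2 j hj hdj hjx⟩, hw.1, ?_, hw.2.2⟩
        rintro x (hx | hx)
        · exact hw.2.1 x hx
        · exact hjx x hx
    have hunion' : (#{w ∈ Ω | (∀ x ∈ S i, w x = a) ∧ Z w} : ℝ) ≤
        #{w ∈ Ω | (∀ x ∈ S i, w x = a) ∧ ∀ j ∈ R, ¬ ∀ x ∈ S j, w x = a} +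
        ∑ j ∈ R with ¬ Disjoint (S i) (S j),
          (#{w ∈ Ω | (∀ x ∈ S i ∪ S j, w x = a) ∧ Z w} : ℝ) := by exact_mod_cast hunion
    have hsum : ∑ j ∈ R with ¬ Disjoint (S i) (S j),
          (#{w ∈ Ω | (∀ x ∈ S i ∪ S j, w x = a) ∧ Z w} : ℝ) ≤
          (∑ j ∈ R, d i j) * #{w ∈ Ω | Z w} := by
      rw [Finset.sum_mul]
      refine (Finset.sum_le_sum fun j hj => ?_).trans
        (Finset.sum_le_sum_of_subset_of_nonneg (filter_subset _ _) fun j _ _ =>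
          mul_nonneg (hd0 i j) (Nat.cast_nonneg _))
      rw [mem_filter] at hj
      exact hFKG j hj.1 hj.2
    have hmain : N * t ≤
        #{w ∈ Ω | (∀ x ∈ S i, w x = a) ∧ ∀ j ∈ R, ¬ ∀ x ∈ S j, w x = a} := by
      have h1 : (#{w ∈ Ω | Z w} : ℝ) * t ≤
        #{w ∈ Ω | (∀ x ∈ S i, w x = a) ∧ ∀ j ∈ R, ¬ ∀ x ∈ S j, w x = a} := by
        rw [ht]; rw [hind] at hunion'; nlinarith
      rcases le_total 0 t with h0 | h0
      · exact (mul_le_mul_of_nonneg_right hNZ h0).trans h1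
      · exact (mul_nonpos_of_nonneg_of_nonpos (Nat.cast_nonneg _) h0).trans (Nat.cast_nonneg _)
    have hsplit : (#{w ∈ Ω | ∀ k ∈ insert i R, ¬ ∀ x ∈ S k, w x = a} : ℝ) +
        #{w ∈ Ω | (∀ x ∈ S i, w x = a) ∧ ∀ j ∈ R, ¬ ∀ x ∈ S j, w x = a} = N := by
      rw [hN]; norm_cast
      rw [← card_filter_add_card_filter_not (s := {w ∈ Ω | ∀ i ∈ R, ¬ ∀ x ∈ S i, w x = a})
        (fun w => ∀ x ∈ S i, w x = a), filter_filter, filter_filter, add_comm]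
      congr 2
      · ext w; simp only [mem_filter]; tauto
      · ext w; simp only [mem_filter, forall_mem_insert]; tauto
    have hN0 : 0 ≤ N := Nat.cast_nonneg _
    have hexp : 1 - t ≤ Real.exp (-t) := by
      have := Real.add_one_le_exp (-t); linarith
    calc _ ≤ N * (1 - t) := by linarith
      _ ≤ N * Real.exp (-t) := mul_le_mul_of_nonneg_left hexp hN0
      _ ≤ _ := by
        rw [neg_add, Real.exp_add, ← mul_assoc]
        exact mul_le_mul_of_nonneg_right ih (Real.exp_nonneg _)

section
open Finset
theorem aux_perm {n : ℕ} (π : Equiv.Perm (Fin n)) (K : Finset (Fin n)) :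
    #{τ : Equiv.Perm (Fin n) | ∀ i ∈ K, π i = τ i} = (n - #K).factorial := by
  classical
  have h1 : #{τ : Equiv.Perm (Fin n) | ∀ i ∈ K, π i = τ i} =
      Fintype.card {f : Equiv.Perm (Fin n) // ∀ i, ¬ (i ∉ K) → f i = i} := by
    rw [Fintype.card_subtype]
    refine Finset.card_bij' (fun τ _ => π⁻¹ * τ) (fun f _ => π * f) ?_ ?_ ?_ ?_
    · intro τ h
      simp only [mem_filter, mem_univ, true_and, not_not] at h ⊢
      intro i hi
      rw [Equiv.Perm.mul_apply, ← h i hi]; simp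
    · intro τ h
      simp only [mem_filter, mem_univ, true_and, not_not] at h ⊢
      intro i hi
      rw [Equiv.Perm.mul_apply, h i hi]
    · intro τ h; simp
    · intro τ h; simp
  rw [h1, ← Fintype.card_congr (Equiv.Perm.subtypeEquivSubtypePerm (fun i : Fin n => i ∉ K)),
    Fintype.card_perm]
  congr 1
  rw [Fintype.card_subtype_compl]; simp

theorem aux_agree {n : ℕ} (π τ : Equiv.Perm (Fin n)) (K : Finset (Fin n))
    (hK : n - 1 ≤ #K) (h : ∀ i ∈ K, π i = τ i) : π = τ := by
  have : π⁻¹ * τ = 1 := by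
    rw [← Equiv.Perm.card_support_le_one]
    have h2 : (π⁻¹ * τ).support ⊆ Kᶜ := by
      intro i hi
      rw [mem_compl]
      intro hiK
      rw [Equiv.Perm.mem_support, Equiv.Perm.mul_apply, ← h i hiK] at hi
      simp at hi
    have := card_le_card h2
    rw [card_compl, Fintype.card_fin] at this
    omega
  exact (inv_mul_eq_one.1 this)

/-- normalised assignment attached to a tuple of permutations -/
def auxV {s n : ℕ} (π : Fin s → Equiv.Perm (Fin n)) (i : Fin n) : Fin (s+1) → Fin n :=
  Fin.cons i (fun j => π j i)

theorem auxV_eq {s n : ℕ} (π ρ : Fin s → Equiv.Perm (Fin n)) (i k : Fin n) :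
    auxV π i = auxV ρ k ↔ i = k ∧ ∀ j, π j i = ρ j k := by
  unfold auxV
  rw [Fin.cons_inj, funext_iff]

theorem auxV_inj {s n : ℕ} (π : Fin s → Equiv.Perm (Fin n)) : Function.Injective (auxV π) :=
  fun i k h => ((auxV_eq π π i k).1 h).1

theorem auxV_inter {s n : ℕ} (π ρ : Fin s → Equiv.Perm (Fin n)) :
    univ.image (auxV π) ∩ univ.image (auxV ρ) =
      ({i | ∀ j, π j i = ρ j i} : Finset (Fin n)).image (auxV π) := by
  ext v
  simp only [mem_inter, mem_image, mem_univ, true_and, mem_filter]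
  constructor
  · rintro ⟨⟨i, rfl⟩, ⟨k, hk⟩⟩
    obtain ⟨rfl, h⟩ := (auxV_eq _ _ _ _).1 hk
    exact ⟨k, fun j => (h j).symm, rfl⟩
  · rintro ⟨i, h, rfl⟩
    exact ⟨⟨i, rfl⟩, i, (auxV_eq _ _ _ _).2 ⟨rfl, fun j => (h j).symm⟩⟩

theorem aux_D {s n : ℕ} (c : ℝ) (hc : 0 < c) (π : Fin s → Equiv.Perm (Fin n)) :
    ∑ ρ : Fin s → Equiv.Perm (Fin n),
      (if π ≠ ρ ∧ ¬ Disjoint (univ.image (auxV π)) (univ.image (auxV ρ)) then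
        1 / c ^ #(univ.image (auxV π) ∪ univ.image (auxV ρ)) else 0) ≤
    ∑ k ∈ Icc 1 (n - 2), (n.choose k : ℝ) * (((n - k).factorial : ℝ)) ^ s * (c ^ k / c ^ (2 * n)) := by
  classical
  have h1 : ∀ ρ : Fin s → Equiv.Perm (Fin n),
      (if π ≠ ρ ∧ ¬ Disjoint (univ.image (auxV π)) (univ.image (auxV ρ)) then
        1 / c ^ #(univ.image (auxV π) ∪ univ.image (auxV ρ)) else 0) ≤
      ∑ k ∈ Icc 1 (n - 2), ∑ K ∈ powersetCard k (univ : Finset (Fin n)),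
        (if ∀ j, ∀ i ∈ K, π j i = ρ j i then c ^ k / c ^ (2 * n) else 0) := by
    intro ρ
    have hnn : ∀ k, ∀ K : Finset (Fin n),
        0 ≤ (if ∀ j, ∀ i ∈ K, π j i = ρ j i then c ^ k / c ^ (2 * n) else 0) := by
      intro k K; split_ifs <;> positivity
    split_ifs with h
    · obtain ⟨hne, hnd⟩ := h
      set E : Finset (Fin n) := {i | ∀ j, π j i = ρ j i} with hE
      have hEc : #(univ.image (auxV π) ∩ univ.image (auxV ρ)) = #E := by
        rw [auxV_inter, card_image_of_injective _ (auxV_inj π)]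
      have hU := card_union_add_card_inter (univ.image (auxV π)) (univ.image (auxV ρ))
      rw [hEc, card_image_of_injective _ (auxV_inj π), card_image_of_injective _ (auxV_inj ρ),
        card_univ, Fintype.card_fin] at hU
      have hpos : 1 ≤ #E := by
        rw [← hEc, Nat.one_le_iff_ne_zero, Ne, card_eq_zero, ← disjoint_iff_inter_eq_empty]
        exact hnd
      have hlt : #E < n - 1 := by
        by_contra hcon
        push Not at hcon
        apply hne
        funext j
        refine aux_agree _ _ E hcon fun i hi => ?_
        rw [hE, mem_filter] at hi
        exact hi.2 j
      have hterm : 1 / c ^ #(univ.image (auxV π) ∪ univ.image (auxV ρ)) =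
          (if ∀ j, ∀ i ∈ E, π j i = ρ j i then c ^ #E / c ^ (2 * n) else 0) := by
        rw [if_pos]
        · rw [show 2 * n = #(univ.image (auxV π) ∪ univ.image (auxV ρ)) + #E by omega, pow_add]
          field_simp
        · intro j i hi
          rw [hE, mem_filter] at hi
          exact hi.2 j
      rw [hterm]
      refine le_trans ?_ (single_le_sum (f := fun k => ∑ K ∈ powersetCard k (univ : Finset (Fin n)),
        (if ∀ j, ∀ i ∈ K, π j i = ρ j i then c ^ k / c ^ (2 * n) else 0))
        (fun k _ => sum_nonneg fun K _ => hnn k K) (a := #E) (by rw [mem_Icc]; omega))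
      exact single_le_sum (f := fun K : Finset (Fin n) =>
        (if ∀ j, ∀ i ∈ K, π j i = ρ j i then c ^ #E / c ^ (2 * n) else 0))
        (fun K _ => hnn _ K) (by simp [mem_powersetCard])
    · exact sum_nonneg fun k _ => sum_nonneg fun K _ => hnn k K
  refine (sum_le_sum fun ρ _ => h1 ρ).trans (le_of_eq ?_)
  rw [sum_comm]
  refine sum_congr rfl fun k _ => ?_
  rw [sum_comm]
  have h2 : ∀ K ∈ powersetCard k (univ : Finset (Fin n)),
      ∑ ρ : Fin s → Equiv.Perm (Fin n),
        (if ∀ j, ∀ i ∈ K, π j i = ρ j i then c ^ k / c ^ (2 * n) else 0) =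
      (((n - k).factorial : ℝ)) ^ s * (c ^ k / c ^ (2 * n)) := by
    intro K hK
    rw [mem_powersetCard] at hK
    rw [← sum_filter, sum_const, nsmul_eq_mul]
    congr 1
    have : ({ρ | ∀ j, ∀ i ∈ K, π j i = ρ j i} : Finset (Fin s → Equiv.Perm (Fin n))) =
        Fintype.piFinset fun j => {τ : Equiv.Perm (Fin n) | ∀ i ∈ K, π j i = τ i} := by
      ext ρ; simp [Fintype.mem_piFinset]
    rw [this, Fintype.card_piFinset]
    simp only [aux_perm, hK.2]
    simp
  rw [sum_congr rfl h2, sum_const, card_powersetCard, card_univ, Fintype.card_fin, nsmul_eq_mul]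
  ring

theorem aux_fact (s n : ℕ) (hn : 3 ≤ n) (c : ℝ) (hc1 : 1 ≤ c)
    (hcond : (((n : ℝ) - 1) / Real.exp 1) ^ s ≥
      c * (2 : ℝ) ^ ((1 : ℝ) / ((n : ℝ) - 1))) :
    c ^ (n - 1) ≤ ((n - 1).factorial : ℝ) ^ s := by
  have hn1 : ((n - 1 : ℕ) : ℝ) = (n : ℝ) - 1 := by
    rw [Nat.cast_sub (by omega)]; simp
  have hpos : (0 : ℝ) ≤ (n : ℝ) - 1 := by rw [← hn1]; positivity
  have h1 := Real.pow_div_factorial_le_exp ((n : ℝ) - 1) hpos (n - 1)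
  have h2 : (((n : ℝ) - 1) / Real.exp 1) ^ (n - 1) ≤ ((n - 1).factorial : ℝ) := by
    rw [div_pow, ← Real.exp_nat_mul, hn1, mul_one]
    rw [div_le_iff₀ (by positivity)] at h1 ⊢
    linarith
  have h3 : c ≤ (((n : ℝ) - 1) / Real.exp 1) ^ s := by
    refine le_trans ?_ hcond
    have : (1 : ℝ) ≤ (2 : ℝ) ^ ((1 : ℝ) / ((n : ℝ) - 1)) :=
      Real.one_le_rpow (by norm_num) (by positivity)
    nlinarith
  calc c ^ (n - 1) ≤ ((((n : ℝ) - 1) / Real.exp 1) ^ s) ^ (n - 1) :=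
        pow_le_pow_left₀ (by linarith) h3 _
    _ = ((((n : ℝ) - 1) / Real.exp 1) ^ (n - 1)) ^ s := by rw [← pow_mul, ← pow_mul, mul_comm]
    _ ≤ _ := pow_le_pow_left₀ (by positivity) h2 _

end

/-- The probability statement: weight functions are chosen uniformly from all functions
`X → {a, …, b-1}`; `α w` counts (vector sets of) feasible assignments of total weight `a·n`.
Then `Pr(α = 0) ≤ exp(-1/(2σ))`, under the stated condition. -/
theorem stmt_0 (s n : ℕ) (hs : 2 ≤ s) (hn : 3 ≤ n)
    (a b c : ℤ) (hab : a ≤ b - 1) (hc : c = b - a) (hc1 : 1 ≤ c)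
    (hcond : (((n : ℝ) - 1) / Real.exp 1) ^ (s - 1) ≥
      (c : ℝ) * (2 : ℝ) ^ ((1 : ℝ) / ((n : ℝ) - 1))) :
    let Ω : Finset ((Fin s → Fin n) → ℤ) :=
      Fintype.piFinset fun _ : Fin s → Fin n => Finset.Icc a (b - 1)
    let α : ((Fin s → Fin n) → ℤ) → ℕ := fun w =>
      Set.ncard {S : Finset (Fin s → Fin n) |
        (∃ A : Fin n → Fin s → Fin n, Feasible A ∧ vecSet A = S) ∧
        ∑ e ∈ S, w e = a * n}
    let σ : ℝ := ∑ k ∈ Finset.Icc 1 (n - 2),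
      (Nat.choose n k : ℝ) * (c : ℝ) ^ k / ((Nat.descFactorial n k : ℝ)) ^ (s - 1)
    ((Ω.filter fun w => α w = 0).card : ℝ) / (Ω.card : ℝ) ≤ Real.exp (-(1 / (2 * σ))) := by
  intro Ω α σ
  classical
  obtain ⟨s, rfl⟩ : ∃ t, s = t + 1 := ⟨s - 1, by omega⟩
  simp only [Nat.add_sub_cancel] at hcond
  have hs1 : s + 1 - 1 = s := by omega
  set I : Finset ℤ := Finset.Icc a (b - 1) with hIdef
  have haI : a ∈ I := Finset.mem_Icc.2 ⟨le_refl _, hab⟩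
  have hIc : (I.card : ℝ) = (c : ℝ) := by
    have : ((I.card : ℕ) : ℤ) = c := by
      rw [hIdef, Int.card_Icc, Int.toNat_of_nonneg (by omega)]; omega
    exact_mod_cast this
  have hc1' : (1 : ℝ) ≤ c := by exact_mod_cast hc1
  have hc0 : (0 : ℝ) < c := by linarith
  let ι := Fin s → Equiv.Perm (Fin n)
  let S : ι → Finset (Fin (s + 1) → Fin n) := fun π => Finset.univ.image (auxV π)
  have hScard : ∀ π, (S π).card = n := by
    intro π
    simp only [S]
    rw [Finset.card_image_of_injective _ (auxV_inj π), Finset.card_univ, Fintype.card_fin]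
  let d : ι → ι → ℝ := fun π ρ => if π ≠ ρ ∧ ¬ Disjoint (S π) (S ρ) then
    1 / (c : ℝ) ^ (S π ∪ S ρ).card else 0
  have hsym : ∀ π ρ, d π ρ = d ρ π := by
    intro π ρ
    simp only [d]
    rw [Finset.union_comm]
    exact if_congr (by rw [disjoint_comm, ne_comm]) rfl rfl
  have hdiag : ∀ π, d π π = 0 := by intro π; simp [d]
  have hd0 : ∀ π ρ, 0 ≤ d π ρ := by
    intro π ρ; simp only [d]; split_ifs <;> positivity
  -- numeric quantities
  set f : ℝ := (n.factorial : ℝ) ^ s with hf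
  have hf0 : 0 < f := by positivity
  set M : ℝ := f / (c : ℝ) ^ n with hM
  have hM0 : 0 < M := by positivity
  have hcardι : (Fintype.card ι : ℝ) = f := by
    simp [ι, hf, Fintype.card_perm]
  have hsumP : ∑ π : ι, 1 / (I.card : ℝ) ^ (S π).card = M := by
    simp only [hScard, hIc]
    rw [Finset.sum_const, nsmul_eq_mul, Finset.card_univ, hcardι, hM]; ring
  have hσterm : ∀ k ∈ Finset.Icc 1 (n - 2),
      (n.choose k : ℝ) * (((n - k).factorial : ℝ)) ^ s * ((c : ℝ) ^ k / (c : ℝ) ^ (2 * n)) =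
      f / (c : ℝ) ^ (2 * n) *
        ((Nat.choose n k : ℝ) * (c : ℝ) ^ k / ((Nat.descFactorial n k : ℝ)) ^ (s + 1 - 1)) := by
    intro k hk
    rw [Finset.mem_Icc] at hk
    have h1 : ((n - k).factorial : ℝ) * (n.descFactorial k : ℝ) = n.factorial := by
      exact_mod_cast Nat.factorial_mul_descFactorial (show k ≤ n by omega)
    have h2 : (0 : ℝ) < (n.descFactorial k : ℝ) := by
      exact_mod_cast Nat.descFactorial_pos.2 (show k ≤ n by omega)
    rw [hs1, hf, ← h1, mul_pow]
    field_simp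
  have hD : ∑ π : ι, ∑ ρ : ι, d π ρ ≤ M ^ 2 * σ := by
    have h1 : ∀ π : ι, ∑ ρ : ι, d π ρ ≤ f / (c : ℝ) ^ (2 * n) * σ := by
      intro π
      refine (aux_D (c : ℝ) hc0 π).trans (le_of_eq ?_)
      rw [Finset.sum_congr rfl hσterm, ← Finset.mul_sum]
    refine (Finset.sum_le_sum fun π _ => h1 π).trans (le_of_eq ?_)
    rw [Finset.sum_const, nsmul_eq_mul, Finset.card_univ, hcardι, hM]
    rw [mul_comm 2 n, pow_mul]; field_simp
  have hσ1 : (n : ℝ) * c / (n : ℝ) ^ s ≤ σ := by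
    have h := Finset.single_le_sum (f := fun k => (Nat.choose n k : ℝ) * (c : ℝ) ^ k /
      ((Nat.descFactorial n k : ℝ)) ^ (s + 1 - 1)) (s := Finset.Icc 1 (n - 2))
      (fun k _ => by positivity) (a := 1) (by rw [Finset.mem_Icc]; omega)
    simpa [σ] using h
  have hn0 : (0 : ℝ) < n := by exact_mod_cast (by omega : 0 < n)
  have hσ0 : 0 < σ := lt_of_lt_of_le (by positivity) hσ1
  have hMσ : 1 ≤ M * σ := by
    have h1 := aux_fact s n hn (c : ℝ) hc1' hcond
    refine le_trans ?_ (mul_le_mul_of_nonneg_left hσ1 hM0.le)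
    have h2 : f = (n : ℝ) ^ s * ((n - 1).factorial : ℝ) ^ s := by
      rw [hf, ← mul_pow]
      congr 1
      exact_mod_cast (Nat.mul_factorial_pred (by omega : n ≠ 0)).symm
    have h3 : (c : ℝ) ^ n = c ^ (n - 1) * c := by
      rw [← pow_succ]; congr 1; omega
    have h4 : M * ((n : ℝ) * c / (n : ℝ) ^ s) =
        n * (((n - 1).factorial : ℝ) ^ s / (c : ℝ) ^ (n - 1)) := by
      rw [hM, h2, h3]; field_simp
    rw [h4]
    have h5 : 1 ≤ ((n - 1).factorial : ℝ) ^ s / (c : ℝ) ^ (n - 1) := by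
      rwa [one_le_div (by positivity)]
    have h6 : (1 : ℝ) ≤ n := by exact_mod_cast (by omega : 1 ≤ n)
    nlinarith
  -- thinning
  obtain ⟨R, -, hR⟩ := aux_thin d hsym hdiag (1 / (M * σ)) (by positivity)
    (by rw [div_le_one (by positivity)]; exact hMσ) Finset.univ
    (fun π => 1 / (I.card : ℝ) ^ (S π).card)
  have hJ := aux_janson I a haI S d hsym hdiag hd0 (by
    intro π ρ hne hnd
    simp only [d]
    rw [if_pos ⟨hne, hnd⟩, hIc]) R
  have hL : 1 / (2 * σ) ≤ auxL (fun π => 1 / (I.card : ℝ) ^ (S π).card) d R := by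
    refine le_trans ?_ hR
    rw [hsumP]
    have h1 : (1 / (M * σ)) ^ 2 * (∑ π : ι, ∑ ρ : ι, d π ρ) ≤
        (1 / (M * σ)) ^ 2 * (M ^ 2 * σ) := mul_le_mul_of_nonneg_left hD (by positivity)
    have h2 : (1 / (M * σ)) ^ 2 * (M ^ 2 * σ) = 1 / σ := by field_simp
    have h3 : 1 / (M * σ) * M = 1 / σ := by field_simp
    have h4 : 1 / (2 * σ) = 1 / σ / 2 := by field_simp
    rw [h3, h4]
    linarith
  have hΩ0 : (0 : ℝ) < Ω.card := by
    have : 0 < Ω.card := Finset.card_pos.2 ⟨fun _ => a, Fintype.mem_piFinset.2 fun _ => haI⟩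
    exact_mod_cast this
  rw [div_le_iff₀ hΩ0, mul_comm]
  refine le_trans ?_ (hJ.trans (mul_le_mul_of_nonneg_left
    (Real.exp_le_exp.2 (neg_le_neg hL)) hΩ0.le))
  norm_cast
  apply Finset.card_le_card
  intro w hw
  rw [Finset.mem_filter] at hw ⊢
  refine ⟨hw.1, fun π _ hall => ?_⟩
  have hα : α w = 0 := hw.2
  simp only [α] at hα
  rw [Set.ncard_eq_zero (Set.toFinite _)] at hα
  refine Set.eq_empty_iff_forall_notMem.1 hα (S π) ⟨⟨auxV π, ?_, rfl⟩, ?_⟩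
  · intro j
    refine Fin.cases ?_ (fun j => ?_) j
    · intro i k h
      simpa [auxV] using h
    · intro i k h
      simpa [auxV] using h
  · rw [Finset.sum_congr rfl hall, Finset.sum_const, hScard, nsmul_eq_mul, mul_comm]
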